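/- Let X be a compact, purely n-unrectifiable metric space with H^n(X) < ∞, and suppose that for H^n-almost every x in X one has liminf_{r→0} H^n(B(x,r))/r^n > 0. Let g : X → [0,1]^n be continuous. Then there exists a sequence of Lipschitz functions f_i : X → [0,1]^n converging to g uniformly (in the supremum distance) such that H^n(f_i(X)) = 0 for every i ∈ ℕ. -/

import Mathlib

open MeasureTheory Metric Set Filter
open scoped ENNReal NNReal Topology

/-- The unit cube `[0,1]^n` in Euclidean space. -/
def unitCube (n : ℕ) : Set (EuclideanSpace ℝ (Fin n)) :=
  {x | ∀ i, x i ∈ Set.Icc (0 : ℝ) 1}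

/-- An `H^n`-measurable set `E` in a metric space `X` is `n`-rectifiable if there are
measurable sets `F i ⊆ ℝ^n` and Lipschitz maps `f i : F i → X` such that
`H^n (E \ ⋃ i, f i '' F i) = 0`. -/
def IsRectifiableSet (n : ℕ) {X : Type*} [MetricSpace X] [MeasurableSpace X] [BorelSpace X]
    (E : Set X) : Prop :=
  MeasurableSet E ∧
  ∃ (F : ℕ → Set (EuclideanSpace ℝ (Fin n))) (f : ℕ → EuclideanSpace ℝ (Fin n) → X),
    (∀ i, MeasurableSet (F i)) ∧ (∀ i, ∃ K : ℝ≥0, LipschitzOnWith K (f i) (F i)) ∧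
    μH[n] (E \ ⋃ i, f i '' F i) = 0

/-- An Eilenberg-type coarea inequality for slices `G w` of a set `A`. -/
theorem exists_measurable_slice_bound {X W : Type*} [MetricSpace X] [MeasurableSpace X]
    [BorelSpace X] [MeasurableSpace W] (ν : Measure W) (k m : ℕ) {A : Set X} (G : W → Set X)
    {c δ : ℝ≥0∞} (hc : c ≠ ∞) (hδ : 0 < δ) (hA : μH[(k + m : ℕ)] A ≠ ∞)
    (h : ∀ T ⊆ A, T.Nonempty → ediam T ≤ δ →
      ν {w | (G w ∩ T).Nonempty} ≤ c * ediam T ^ m) :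
    ∃ φ : W → ℝ≥0∞, Measurable φ ∧ (∀ w, μH[k] (A ∩ G w) ≤ φ w) ∧
      ∫⁻ w, φ w ∂ν ≤ c * μH[(k + m : ℕ)] A := by
  set H := μH[(k + m : ℕ)] A with hH
  have hcov : ∀ j : ℕ, ∃ t : ℕ → Set X, A ⊆ ⋃ i, t i ∧
      (∀ i, ediam (t i) ≤ min δ ((j : ℝ≥0∞) + 1)⁻¹) ∧
      ∑' i, ⨆ _ : (t i).Nonempty, ediam (t i) ^ (k + m) ≤ H + ((j : ℝ≥0∞) + 1)⁻¹ := by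
    intro j
    have hpos : (0 : ℝ≥0∞) < ((j : ℝ≥0∞) + 1)⁻¹ := by
      simp
    have h1 : (⨅ (t : ℕ → Set X) (_ : A ⊆ ⋃ n, t n)
        (_ : ∀ n, ediam (t n) ≤ min δ ((j : ℝ≥0∞) + 1)⁻¹),
          ∑' n, ⨆ _ : (t n).Nonempty, ediam (t n) ^ ((k + m : ℕ) : ℝ)) <
          H + ((j : ℝ≥0∞) + 1)⁻¹ := by
      refine lt_of_le_of_lt ?_ (ENNReal.lt_add_right hA hpos.ne')
      rw [hH, Measure.hausdorffMeasure_apply]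
      exact le_iSup₂_of_le _ (lt_min hδ hpos) le_rfl
    simp only [iInf_lt_iff] at h1
    obtain ⟨t, h2, h3, h4⟩ := h1
    refine ⟨t, h2, h3, ?_⟩
    simpa only [ENNReal.rpow_natCast] using h4.le
  choose t htA htd hts using hcov
  let T : ℕ → ℕ → Set X := fun j i => t j i ∩ A
  let S : ℕ → ℕ → Set W := fun j i => toMeasurable ν {w | (G w ∩ T j i).Nonempty}
  let φ : ℕ → W → ℝ≥0∞ := fun j w => ∑' i, (S j i).indicator (fun _ => ediam (T j i) ^ k) w
  have hφ : ∀ j, Measurable (φ j) := fun j =>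
    Measurable.tsum fun i => measurable_const.indicator (measurableSet_toMeasurable _ _)
  have hTt : ∀ j i, ediam (T j i) ≤ ediam (t j i) := fun j i => ediam_mono inter_subset_left
  have hinv : Tendsto (fun j : ℕ => ((j : ℝ≥0∞) + 1)⁻¹) atTop (𝓝 0) := by
    have := ENNReal.tendsto_inv_nat_nhds_zero.comp (tendsto_add_atTop_nat 1)
    simpa [Function.comp_def] using this
  refine ⟨fun w => liminf (fun j => φ j w) atTop, Measurable.liminf hφ, fun w => ?_, ?_⟩
  · have hle := Measure.hausdorffMeasure_le_liminf_tsum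
      (ι := fun j => {i // (G w ∩ T j i).Nonempty}) (k : ℝ) (A ∩ G w) (l := atTop)
      (fun j : ℕ => ((j : ℝ≥0∞) + 1)⁻¹) hinv (fun j i => T j i.1)
      (Eventually.of_forall fun j i => (hTt j i.1).trans ((htd j i.1).trans (min_le_right _ _)))
      (Eventually.of_forall fun j x hx => by
        obtain ⟨i, hi⟩ := mem_iUnion.1 (htA j hx.1)
        exact mem_iUnion.2 ⟨⟨i, ⟨x, hx.2, hi, hx.1⟩⟩, hi, hx.1⟩)
    refine hle.trans (liminf_le_liminf (Eventually.of_forall fun j => ?_))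
    simp only [ENNReal.rpow_natCast]
    refine (tsum_subtype {i | (G w ∩ T j i).Nonempty}
      (fun i => ediam (T j i) ^ k)).trans_le ?_
    refine ENNReal.tsum_le_tsum fun i => ?_
    by_cases hi : (G w ∩ T j i).Nonempty
    · have : w ∈ S j i := subset_toMeasurable ν _ hi
      rw [indicator_of_mem this, indicator_of_mem (by exact hi)]
    · rw [indicator_of_notMem (by exact hi)]; exact zero_le
  · refine (lintegral_liminf_le hφ).trans ?_
    have hj : ∀ j, ∫⁻ w, φ j w ∂ν ≤ c * (H + ((j : ℝ≥0∞) + 1)⁻¹) := by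
      intro j
      rw [lintegral_tsum fun i =>
        (measurable_const.indicator (measurableSet_toMeasurable _ _)).aemeasurable]
      refine le_trans ?_ (mul_le_mul_right (hts j) c)
      rw [← ENNReal.tsum_mul_left]
      refine ENNReal.tsum_le_tsum fun i => ?_
      rw [lintegral_indicator_const (measurableSet_toMeasurable _ _), measure_toMeasurable]
      rcases (T j i).eq_empty_or_nonempty with he | hne
      · simp [he]
      · have hne' : (t j i).Nonempty := hne.mono inter_subset_left
        rw [iSup_pos hne']
        calc ediam (T j i) ^ k * ν {w | (G w ∩ T j i).Nonempty}
            ≤ ediam (T j i) ^ k * (c * ediam (T j i) ^ m) := by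
              gcongr
              exact h _ inter_subset_right hne
                ((hTt j i).trans ((htd j i).trans (min_le_left _ _)))
          _ = c * ediam (T j i) ^ (k + m) := by rw [pow_add]; ring
          _ ≤ c * ediam (t j i) ^ (k + m) :=
              mul_le_mul' le_rfl (pow_le_pow_left' (hTt j i) _)
    have hlim : Tendsto (fun j : ℕ => c * (H + ((j : ℝ≥0∞) + 1)⁻¹)) atTop (𝓝 (c * H)) := by
      have := ENNReal.Tendsto.const_mul (a := c) (hinv.const_add H) (Or.inr hc)
      simpa using this
    calc liminf (fun j => ∫⁻ w, φ j w ∂ν) atTop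
        ≤ liminf (fun j : ℕ => c * (H + ((j : ℝ≥0∞) + 1)⁻¹)) atTop :=
          liminf_le_liminf (Eventually.of_forall hj)
      _ = c * H := hlim.liminf_eq

/-- A set of finite zero-dimensional Hausdorff measure is finite. -/
theorem finite_of_hausdorffMeasure_zero_lt_top {X : Type*} [MetricSpace X] [MeasurableSpace X]
    [BorelSpace X] {s : Set X} (hs : μH[0] s < ∞) : s.Finite := by
  by_contra hinf
  obtain ⟨N, hN⟩ := ENNReal.exists_nat_gt hs.ne
  obtain ⟨t, hts, htN⟩ := Set.Infinite.exists_subset_card_eq hinf N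
  have h1 : μH[0] (t : Set X) = N := by
    rw [← MeasureTheory.sum_measure_singleton]
    simp [htN]
  exact absurd (measure_mono (μ := μH[0]) hts) (by rw [h1]; exact not_le.2 hN)

/-- Almost every fibre of a Lipschitz map from a space of finite `n`-dimensional measure to an
`n`-dimensional space is finite. -/
theorem ae_finite_fiber {X E : Type*} [MetricSpace X] [MeasurableSpace X] [BorelSpace X]
    [NormedAddCommGroup E] [NormedSpace ℝ E] [FiniteDimensional ℝ E] [MeasurableSpace E]
    [BorelSpace E] (ν : Measure E) [ν.IsAddHaarMeasure] {n : ℕ} (hn : Module.finrank ℝ E = n)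
    {g : X → E} {K : ℝ≥0} (hg : LipschitzWith K g) (hX : μH[n] (univ : Set X) ≠ ∞) :
    ∀ᵐ y ∂ν, (g ⁻¹' {y}).Finite := by
  have hV : ν (ball (0 : E) 1) ≠ ∞ := measure_ball_lt_top.ne
  obtain ⟨φ, hφm, hφ, hφi⟩ := exists_measurable_slice_bound ν 0 n (A := (univ : Set X))
    (fun y => g ⁻¹' {y}) (c := K ^ n * ν (ball (0 : E) 1)) (δ := 1)
    (ENNReal.mul_ne_top (by simp) hV) one_pos (by simpa using hX) (by
      rintro T - ⟨x₀, hx₀⟩ hT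
      have hT' : ediam T ≠ ∞ := ne_top_of_le_ne_top ENNReal.one_ne_top hT
      have hsub : {w | (g ⁻¹' {w} ∩ T).Nonempty} ⊆ closedBall (g x₀) (K * diam T) := by
        rintro w ⟨x, hx, hxT⟩
        rw [← hx]
        exact (hg.dist_le_mul x x₀).trans (mul_le_mul_of_nonneg_left
          (dist_le_diam_of_mem' hT' hxT hx₀) K.2)
      refine (measure_mono hsub).trans ?_
      rw [Measure.addHaar_closedBall ν _ (by positivity), hn, mul_pow,
        ENNReal.ofReal_mul (by positivity), ENNReal.ofReal_pow (by positivity),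
        ENNReal.ofReal_pow (by positivity), ENNReal.ofReal_coe_nnreal, diam,
        ENNReal.ofReal_toReal hT']
      exact le_of_eq (by ring))
  have hlt : ∫⁻ y, φ y ∂ν ≠ ∞ := by
    refine ne_top_of_le_ne_top (ENNReal.mul_ne_top (ENNReal.mul_ne_top (by simp) hV) ?_) hφi
    simpa using hX
  filter_upwards [ae_lt_top hφm hlt] with y hy
  refine finite_of_hausdorffMeasure_zero_lt_top (lt_of_le_of_lt ?_ hy)
  simpa using hφ y

/-- The set of `v` in a ball such that a dyadic part of the segment from `y` to `y + v` meets a set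
of diameter at most `e` has measure of order `e ^ m` in dimension `m + 1`. -/
theorem measure_shadow_le {E : Type*}
    [NormedAddCommGroup E] [NormedSpace ℝ E] [FiniteDimensional ℝ E] [MeasurableSpace E]
    [BorelSpace E] (ν : Measure E) [ν.IsAddHaarMeasure] {m : ℕ}
    (hn : Module.finrank ℝ E = m + 1) {Q : Set E} {y : E} {a r e : ℝ} (ha : 0 < a)
    (he : 0 < e) (her : e ≤ a * r) (hQ : ∀ p ∈ Q, ∀ q ∈ Q, dist p q ≤ e) :
    ν {v | ‖v‖ ≤ r ∧ ∃ t ∈ Icc (a / 2) a, y + t • v ∈ Q} ≤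
      ENNReal.ofReal (3 ^ (m + 2) * r * (e / a) ^ m) * ν (ball 0 1) := by
  rcases Set.eq_empty_or_nonempty {v | ‖v‖ ≤ r ∧ ∃ t ∈ Icc (a / 2) a, y + t • v ∈ Q} with
    h0 | ⟨v₀, hv₀, t₀, ht₀, hp₀⟩
  · rw [h0]; simp
  set u := t₀ • v₀ with hu
  have ht₀' : 0 < t₀ := lt_of_lt_of_le (by positivity) ht₀.1
  have hur : ‖u‖ ≤ a * r := by
    rw [hu, norm_smul, Real.norm_of_nonneg ht₀'.le]
    exact mul_le_mul ht₀.2 hv₀ (norm_nonneg _) ha.le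
  have har : 0 < a * r := he.trans_le her
  have hr : 0 < r := pos_of_mul_pos_right har ha.le
  set N := ⌈a * r / e⌉₊ with hN
  have hNpos : 0 < N := Nat.ceil_pos.2 (by positivity)
  have hN1 : a * r / e ≤ N := Nat.le_ceil _
  have hN2 : (N : ℝ) < a * r / e + 1 := Nat.ceil_lt_add_one (by positivity)
  have hNpos' : (0 : ℝ) < N := by exact_mod_cast hNpos
  have hcover : {v | ‖v‖ ≤ r ∧ ∃ t ∈ Icc (a / 2) a, y + t • v ∈ Q} ⊆
      ⋃ j ∈ Finset.range (N + 1), closedBall (((1 + (j : ℝ) / N) / a) • u) (3 * e / a) := by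
    rintro v ⟨-, t, ht, hp⟩
    have ht' : 0 < t := lt_of_lt_of_le (by positivity) ht.1
    have hs1 : 1 ≤ a / t := (one_le_div ht').2 ht.2
    have hs2 : a / t ≤ 2 := by rw [div_le_iff₀ ht']; linarith [ht.1]
    set s := a / t with hs
    have hfl : (⌊N * (s - 1)⌋₊ : ℝ) ≤ N * (s - 1) := Nat.floor_le (by nlinarith)
    have hfl' : N * (s - 1) < ⌊N * (s - 1)⌋₊ + 1 := Nat.lt_floor_add_one _
    set j := ⌊N * (s - 1)⌋₊ with hj
    have hjN : j ≤ N := by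
      have : (j : ℝ) ≤ N := by nlinarith
      exact_mod_cast this
    refine mem_iUnion₂.2 ⟨j, Finset.mem_range.2 (by omega), ?_⟩
    rw [mem_closedBall, dist_eq_norm]
    have hdec : v - ((1 + (j : ℝ) / N) / a) • u =
        (s / a) • ((y + t • v) - (y + u)) + ((s - 1 - j / N) / a) • u := by
      have h1 : (s / a) * t = 1 := by rw [hs]; field_simp
      rw [add_sub_add_left_eq_sub, smul_sub, smul_smul (s / a) t v, h1, one_smul]
      have h2 : (s - 1 - j / N) / a = s / a - (1 + (j : ℝ) / N) / a := by ring
      rw [h2, sub_smul]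
      abel
    rw [hdec]
    have hn1 : ‖(s / a) • ((y + t • v) - (y + u))‖ ≤ 2 / a * e := by
      rw [norm_smul, Real.norm_of_nonneg (by positivity), ← dist_eq_norm]
      exact mul_le_mul (by gcongr) (hQ _ hp _ hp₀) dist_nonneg (by positivity)
    have hn2 : ‖((s - 1 - j / N) / a) • u‖ ≤ e / a := by
      have habs : |s - 1 - j / N| ≤ 1 / N := by
        rw [abs_le]
        constructor
        · have : (j : ℝ) / N ≤ s - 1 := by rw [div_le_iff₀ hNpos']; linarith
          have : 0 < 1 / (N : ℝ) := by positivity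
          linarith
        · have : s - 1 ≤ (j + 1 : ℝ) / N := by rw [le_div_iff₀ hNpos']; linarith
          rw [add_div] at this
          linarith
      rw [norm_smul, Real.norm_eq_abs, abs_div, abs_of_pos ha]
      calc |s - 1 - j / N| / a * ‖u‖ ≤ (1 / N) / a * (a * r) := by gcongr
        _ = r / N := by field_simp
        _ ≤ e / a := by
          rw [div_le_div_iff₀ hNpos' ha]
          rw [div_le_iff₀ he] at hN1
          linarith
    calc _ ≤ 2 / a * e + e / a := norm_add_le_of_le hn1 hn2
      _ = 3 * e / a := by ring
  refine (measure_mono hcover).trans ((measure_biUnion_finset_le _ _).trans ?_)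
  simp_rw [Measure.addHaar_closedBall ν _ (show 0 ≤ 3 * e / a by positivity), hn]
  rw [Finset.sum_const, Finset.card_range, nsmul_eq_mul, ← mul_assoc]
  gcongr
  rw [← ENNReal.ofReal_natCast, ← ENNReal.ofReal_mul (by positivity)]
  refine ENNReal.ofReal_le_ofReal ?_
  have h1 : 1 ≤ a * r / e := (one_le_div he).2 her
  calc ((N + 1 : ℕ) : ℝ) * (3 * e / a) ^ (m + 1)
      ≤ (3 * (a * r / e)) * (3 * e / a) ^ (m + 1) := by
        gcongr; push_cast; linarith
    _ = 3 ^ (m + 2) * r * (e / a) ^ m := by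
        have h2 : a * r / e * (e / a) = r := by field_simp
        rw [mul_div_assoc 3 e a, mul_pow, pow_succ (e / a) m]
        linear_combination (3 ^ (m + 2) * (e / a) ^ m) * h2

section Slices

variable {X E : Type*} [MetricSpace X] [MeasurableSpace X] [BorelSpace X]
  [NormedAddCommGroup E] [NormedSpace ℝ E] [FiniteDimensional ℝ E] [MeasurableSpace E]
  [BorelSpace E]

/-- Coarea inequality for the preimages of dyadic parts of segments issued from `y`. -/
theorem exists_measurable_radial_slice_bound (ν : Measure E) [ν.IsAddHaarMeasure] {m : ℕ}
    (hn : Module.finrank ℝ E = m + 1) {g : X → E} {K : ℝ≥0} (hK : 0 < K)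
    (hg : LipschitzWith K g) {A : Set X} (hA : μH[(m + 1 : ℕ)] A ≠ ∞) (y : E) {a r : ℝ}
    (ha : 0 < a) (hr : 0 < r) :
    ∃ φ : E → ℝ≥0∞, Measurable φ ∧
      (∀ v, ‖v‖ ≤ r → μH[1] (A ∩ {x | ∃ t ∈ Icc (a / 2) a, g x = y + t • v}) ≤ φ v) ∧
      ∫⁻ v, φ v ∂ν ≤
        ENNReal.ofReal (3 ^ (m + 2) * r * (K / a) ^ m) * ν (ball 0 1) * μH[(m + 1 : ℕ)] A := by
  have hV : ν (ball (0 : E) 1) ≠ ∞ := measure_ball_lt_top.ne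
  have hK' : (0 : ℝ) < K := hK
  obtain ⟨φ, hφm, hφ, hφi⟩ := exists_measurable_slice_bound ν 1 m (A := A)
    (fun v => {x | ‖v‖ ≤ r ∧ ∃ t ∈ Icc (a / 2) a, g x = y + t • v})
    (c := ENNReal.ofReal (3 ^ (m + 2) * r * (K / a) ^ m) * ν (ball (0 : E) 1))
    (δ := ENNReal.ofReal (a * r / (2 * K)))
    (ENNReal.mul_ne_top (by simp) hV) (ENNReal.ofReal_pos.2 (by positivity))
    (by rwa [add_comm 1 m]) (by
      rintro T - - hT
      have hT' : ediam T ≠ ∞ := ne_top_of_le_ne_top ENNReal.ofReal_ne_top hT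
      have hd : diam T ≤ a * r / (2 * K) := by
        rw [diam]; exact ENNReal.toReal_le_of_le_ofReal (by positivity) hT
      have hd' : diam T < a * r / K := by
        refine hd.trans_lt ?_
        gcongr
        linarith
      have hsub : {v | ({x | ‖v‖ ≤ r ∧ ∃ t ∈ Icc (a / 2) a, g x = y + t • v} ∩ T).Nonempty} ⊆
          {v | ‖v‖ ≤ r ∧ ∃ t ∈ Icc (a / 2) a, y + t • v ∈ g '' T} := by
        rintro v ⟨x, ⟨hv, t, ht, hx⟩, hxT⟩
        exact ⟨hv, t, ht, x, hxT, hx⟩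
      have hev : ∀ᶠ e in 𝓝[>] diam T,
          ν {v | ({x | ‖v‖ ≤ r ∧ ∃ t ∈ Icc (a / 2) a, g x = y + t • v} ∩ T).Nonempty} ≤
            ENNReal.ofReal (3 ^ (m + 2) * r * (K * e / a) ^ m) * ν (ball 0 1) := by
        filter_upwards [Ioo_mem_nhdsGT hd'] with e he
        have he0 : 0 < e := diam_nonneg.trans_lt he.1
        refine (measure_mono hsub).trans (measure_shadow_le ν hn ha (by positivity) ?_ ?_)
        · have := he.2.le
          rw [le_div_iff₀ hK'] at this
          linarith
        · rintro _ ⟨p, hp, rfl⟩ _ ⟨q, hq, rfl⟩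
          exact (hg.dist_le_mul p q).trans (mul_le_mul_of_nonneg_left
            ((dist_le_diam_of_mem' hT' hp hq).trans he.1.le) hK'.le)
      have hlim : Tendsto (fun e : ℝ =>
          ENNReal.ofReal (3 ^ (m + 2) * r * (K * e / a) ^ m) * ν (ball 0 1)) (𝓝[>] diam T)
          (𝓝 (ENNReal.ofReal (3 ^ (m + 2) * r * (K * diam T / a) ^ m) * ν (ball 0 1))) := by
        refine ENNReal.Tendsto.mul_const ?_ (Or.inr hV)
        refine ENNReal.tendsto_ofReal (Tendsto.mono_left ?_ nhdsWithin_le_nhds)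
        exact Continuous.tendsto (by fun_prop) _
      refine (ge_of_tendsto hlim hev).trans (le_of_eq ?_)
      have h1 : 3 ^ (m + 2) * r * (K * diam T / a) ^ m =
          3 ^ (m + 2) * r * (K / a : ℝ) ^ m * diam T ^ m := by
        rw [mul_div_right_comm, mul_pow]; ring
      rw [h1, ENNReal.ofReal_mul (by positivity), ENNReal.ofReal_pow diam_nonneg, diam,
        ENNReal.ofReal_toReal hT']
      ring)
  rw [add_comm 1 m] at hφi
  refine ⟨φ, hφm, fun v hv => ?_, hφi⟩
  refine le_trans (measure_mono ?_) (by simpa using hφ v)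
  exact inter_subset_inter_right _ fun x hx => ⟨hv, hx⟩

/-- If the pushforward of the Hausdorff measure has bounded density at `y`, then the preimages of
segments `[y, y + v]` have length of order `r` on average over `‖v‖ ≤ r`. -/
theorem exists_measurable_segment_bound (ν : Measure E) [ν.IsAddHaarMeasure] {m : ℕ}
    (hn : Module.finrank ℝ E = m + 1) {g : X → E} {K : ℝ≥0} (hK : 0 < K)
    (hg : LipschitzWith K g) {y : E} (hfin : (g ⁻¹' {y}).Finite) {Λ R : ℝ} (hΛ : 0 ≤ Λ)
    (hR : ∀ s ∈ Ioc 0 R,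
      μH[(m + 1 : ℕ)] (g ⁻¹' closedBall y s) ≤ ENNReal.ofReal (Λ * s ^ (m + 1)))
    {r : ℝ} (hr : r ∈ Ioc 0 R) :
    ∃ φ : E → ℝ≥0∞, Measurable φ ∧
      (∀ v, ‖v‖ ≤ r → μH[1] (g ⁻¹' segment ℝ y (y + v)) ≤ φ v) ∧
      ∫⁻ v, φ v ∂ν ≤
        ENNReal.ofReal (2 * 3 ^ (m + 2) * K ^ m * Λ * r ^ (m + 2)) * ν (ball 0 1) := by
  have hr0 := hr.1
  have hs : ∀ j : ℕ, (1 / 2 : ℝ) ^ j * r ∈ Ioc 0 R := fun j =>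
    ⟨by positivity, le_trans (mul_le_of_le_one_left hr0.le
      (pow_le_one₀ (by norm_num) (by norm_num))) hr.2⟩
  have hpiece := fun j : ℕ => exists_measurable_radial_slice_bound ν hn hK hg
    (A := g ⁻¹' closedBall y ((1 / 2 : ℝ) ^ j * r))
    (ne_top_of_le_ne_top ENNReal.ofReal_ne_top (hR _ (hs j))) y
    (a := (1 / 2 : ℝ) ^ j) (by positivity) hr0
  choose φ hφm hφ hφi using hpiece
  refine ⟨fun v => ∑' j, φ j v, Measurable.tsum hφm, fun v hv => ?_, ?_⟩
  · have hcover : g ⁻¹' segment ℝ y (y + v) ⊆ g ⁻¹' {y} ∪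
        ⋃ j : ℕ, g ⁻¹' closedBall y ((1 / 2 : ℝ) ^ j * r) ∩
          {x | ∃ t ∈ Icc ((1 / 2 : ℝ) ^ j / 2) ((1 / 2 : ℝ) ^ j), g x = y + t • v} := by
      intro x hx
      rw [mem_preimage, segment_eq_image'] at hx
      obtain ⟨t, ht, htx⟩ := hx
      simp only [add_sub_cancel_left] at htx
      rcases ht.1.eq_or_lt with h0 | h0
      · left
        rw [mem_preimage, ← htx, ← h0]; simp
      · right
        obtain ⟨j, hj1, hj2⟩ := exists_nat_pow_near_of_lt_one h0 ht.2
          (show (0 : ℝ) < 1 / 2 by norm_num) (by norm_num)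
        refine mem_iUnion.2 ⟨j, ?_, t, ⟨?_, hj2⟩, htx.symm⟩
        · rw [mem_preimage, ← htx, mem_closedBall, dist_eq_norm, add_sub_cancel_left, norm_smul,
            Real.norm_of_nonneg h0.le]
          exact mul_le_mul hj2 hv (norm_nonneg _) (by positivity)
        · rw [pow_succ] at hj1
          linarith
    refine (measure_mono hcover).trans ((measure_union_le _ _).trans ?_)
    have := Measure.nullSingletonClass_hausdorff X (d := 1) one_pos
    rw [hfin.measure_zero, zero_add]
    exact (measure_iUnion_le _).trans (ENNReal.tsum_le_tsum fun j => hφ j v hv)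
  · rw [lintegral_tsum fun j => (hφm j).aemeasurable]
    have hj : ∀ j, ∫⁻ v, φ j v ∂ν ≤
        ENNReal.ofReal (3 ^ (m + 2) * K ^ m * Λ * r ^ (m + 2) * (1 / 2) ^ j) *
          ν (ball 0 1) := by
      intro j
      refine (hφi j).trans ((mul_le_mul' le_rfl (hR _ (hs j))).trans (le_of_eq ?_))
      rw [mul_right_comm, ← ENNReal.ofReal_mul (by positivity)]
      congr 2
      generalize hb : (1 / 2 : ℝ) ^ j = b
      have hb0 : b ≠ 0 := by rw [← hb]; positivity
      rw [div_pow, mul_pow]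
      field_simp
      ring
    refine (ENNReal.tsum_le_tsum hj).trans (le_of_eq ?_)
    rw [ENNReal.tsum_mul_right, ← ENNReal.ofReal_tsum_of_nonneg (fun j => by positivity)
      (summable_geometric_two.mul_left _), tsum_mul_left, tsum_geometric_two]
    congr 2
    ring

/-- Under a uniform density bound at `y`, most segments `[y, z]` have preimages of length
comparable to the scale. -/
theorem exists_segment_length_bound (ν : Measure E) [ν.IsAddHaarMeasure] {m : ℕ}
    (hn : Module.finrank ℝ E = m + 1) {g : X → E} {K : ℝ≥0} (hK : 0 < K)
    (hg : LipschitzWith K g) {Λ θ : ℝ} (hΛ : 0 ≤ Λ) (hθ : 0 < θ) :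
    ∃ T : ℝ, 0 < T ∧ ∀ (y : E) (R : ℝ), (g ⁻¹' {y}).Finite →
      (∀ s ∈ Ioc 0 R,
        μH[(m + 1 : ℕ)] (g ⁻¹' closedBall y s) ≤ ENNReal.ofReal (Λ * s ^ (m + 1))) →
      ∀ r ∈ Ioc 0 R,
        ν {z | dist z y ≤ r ∧ ENNReal.ofReal (T * r) < μH[1] (g ⁻¹' segment ℝ y z)} ≤
          ENNReal.ofReal (θ * r ^ (m + 1)) * ν (ball 0 1) := by
  set T := 2 * 3 ^ (m + 2) * K ^ m * Λ / θ + 1 with hT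
  have hT0 : 0 < T := by positivity
  refine ⟨T, hT0, fun y R hfin hR r hr => ?_⟩
  have hr0 := hr.1
  obtain ⟨φ, hφm, hφ, hφi⟩ := exists_measurable_segment_bound ν hn hK hg hfin hΛ hR hr
  have hTr : ENNReal.ofReal (T * r) ≠ 0 := (ENNReal.ofReal_pos.2 (by positivity)).ne'
  have hsub : {z | dist z y ≤ r ∧ ENNReal.ofReal (T * r) < μH[1] (g ⁻¹' segment ℝ y z)} ⊆
      (fun z => z + -y) ⁻¹' {v | ENNReal.ofReal (T * r) ≤ φ v} := by
    rintro z ⟨hz, hlt⟩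
    have := hφ (z + -y) (by rwa [← sub_eq_add_neg, ← dist_eq_norm])
    rw [add_comm z, add_neg_cancel_left] at this
    have := hlt.le.trans this
    rwa [add_comm (-y)] at this
  refine (measure_mono hsub).trans ?_
  rw [measure_preimage_add_right]
  refine (meas_ge_le_lintegral_div hφm.aemeasurable hTr ENNReal.ofReal_ne_top).trans ?_
  refine ENNReal.div_le_of_le_mul (hφi.trans ?_)
  rw [mul_right_comm (ENNReal.ofReal _), ← ENNReal.ofReal_mul (by positivity)]
  refine mul_le_mul' (ENNReal.ofReal_le_ofReal ?_) le_rfl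
  have h1 : 2 * 3 ^ (m + 2) * K ^ m * Λ ≤ θ * T := by
    rw [hT, mul_add, mul_div_cancel₀ _ hθ.ne']
    linarith
  calc 2 * 3 ^ (m + 2) * K ^ m * Λ * r ^ (m + 2) ≤ θ * T * r ^ (m + 2) := by gcongr
    _ = θ * r ^ (m + 1) * (T * r) := by ring

end Slices

/-- The diameter of a connected set is at most its one-dimensional Hausdorff measure. -/
theorem edist_le_hausdorffMeasure_of_isPreconnected {X : Type*} [MetricSpace X]
    [MeasurableSpace X] [BorelSpace X] {s : Set X} (hs : IsPreconnected s) {x y : X}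
    (hx : x ∈ s) (hy : y ∈ s) : edist x y ≤ μH[1] s := by
  have himg : IsPreconnected (dist x '' s) := hs.image _ (by fun_prop)
  have hsub : Icc 0 (dist x y) ⊆ dist x '' s :=
    himg.Icc_subset ⟨x, hx, dist_self x⟩ ⟨y, hy, rfl⟩
  calc edist x y = volume (Icc 0 (dist x y)) := by
        rw [Real.volume_Icc, sub_zero, edist_dist]
    _ ≤ μH[1] (dist x '' s) := by
        rw [← hausdorffMeasure_real]; exact measure_mono hsub
    _ ≤ μH[1] s := by
        simpa using (LipschitzWith.dist_right x).hausdorffMeasure_image_le zero_le_one s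

/-- In a compact Hausdorff space, a neighbourhood of a connected component contains a clopen
neighbourhood of it. -/
theorem exists_isClopen_connectedComponent_subset {Y : Type*} [TopologicalSpace Y]
    [CompactSpace Y] [T2Space Y] {y : Y} {W : Set Y} (hW : IsOpen W)
    (h : connectedComponent y ⊆ W) : ∃ V, IsClopen V ∧ y ∈ V ∧ V ⊆ W := by
  rw [connectedComponent_eq_iInter_isClopen] at h
  have hne : Nonempty {s : Set Y // IsClopen s ∧ y ∈ s} := ⟨⟨univ, isClopen_univ, mem_univ y⟩⟩
  obtain ⟨V, hV⟩ := exists_subset_nhds_of_compactSpace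
    (V := fun s : {s : Set Y // IsClopen s ∧ y ∈ s} => (s : Set Y))
    (fun s t => ⟨⟨s ∩ t, s.2.1.inter t.2.1, s.2.2, t.2.2⟩, inter_subset_left,
      inter_subset_right⟩) (fun s => s.2.1.1) (fun z hz => hW.mem_nhds (h hz))
  exact ⟨V, V.2.1, V.2.2, hV⟩

section Stable

variable {X E : Type*} [MetricSpace X] [CompactSpace X] [MeasurableSpace X] [BorelSpace X]
  [NormedAddCommGroup E] [NormedSpace ℝ E]

/-- Either the preimage of the segment `[y, z]` connects a point `x` over `y` to a point over `z`,
or the value `y` can be removed near `x` by pushing along the segment. -/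
theorem exists_fiber_point_or_exists_push {g : X → E} (hg : Continuous g) (x : X) (z : E) {ρ : ℝ}
    (hlt : μH[1] (g ⁻¹' segment ℝ (g x) z) < ENNReal.ofReal ρ) :
    (∃ x', g x' = z ∧ edist x x' ≤ μH[1] (g ⁻¹' segment ℝ (g x) z)) ∨
    ∃ τ : C(X, ℝ), (∀ p, τ p ∈ Icc (0 : ℝ) 1) ∧ τ x ≠ 0 ∧
      ∀ p, τ p ≠ 0 → dist p x < ρ ∧ g p + τ p • (g x - z) ≠ g x := by
  set G := g ⁻¹' segment ℝ (g x) z with hG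
  have hseg : IsClosed (segment ℝ (g x) z) := by
    rw [segment_eq_image_lineMap]
    exact (isCompact_Icc.image (by fun_prop)).isClosed
  have hGc : IsClosed G := hseg.preimage hg
  have hGcomp : CompactSpace G := isCompact_iff_compactSpace.1 hGc.isCompact
  let x₀ : G := ⟨x, left_mem_segment ℝ _ _⟩
  have hdist : ∀ p ∈ connectedComponent x₀, edist x p ≤ μH[1] G := by
    intro p hp
    have hpre : IsPreconnected (Subtype.val '' connectedComponent x₀) :=
      isPreconnected_connectedComponent.image _ continuous_subtype_val.continuousOn
    refine (edist_le_hausdorffMeasure_of_isPreconnected hpre ⟨x₀, mem_connectedComponent, rfl⟩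
      ⟨p, hp, rfl⟩).trans (measure_mono ?_)
    rintro _ ⟨q, -, rfl⟩
    exact q.2
  by_cases hex : ∃ p ∈ connectedComponent x₀, g p = z
  · obtain ⟨p, hp, hpz⟩ := hex
    exact Or.inl ⟨p, hpz, hdist p hp⟩
  right
  push Not at hex
  have hgG : Continuous fun p : G => g p := hg.comp continuous_subtype_val
  have hdG : Continuous fun p : G => dist (p : X) x := continuous_subtype_val.dist continuous_const
  obtain ⟨V, hVc, hxV, hVW⟩ := exists_isClopen_connectedComponent_subset (y := x₀)
    (W := {p : G | g p ≠ z ∧ dist (p : X) x < ρ})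
    ((isOpen_ne_fun hgG continuous_const).inter (isOpen_lt hdG continuous_const))
    (fun p hp => ⟨hex p hp, by
      have := (hdist p hp).trans_lt hlt
      rw [edist_dist, ENNReal.ofReal_lt_ofReal_iff'] at this
      rw [dist_comm]; exact this.1⟩)
  have hV1 : IsClosed (Subtype.val '' V : Set X) :=
    hGc.isClosedEmbedding_subtypeVal.isClosedMap _ hVc.1
  have hV2 : IsClosed (Subtype.val '' Vᶜ : Set X) :=
    hGc.isClosedEmbedding_subtypeVal.isClosedMap _ hVc.2.isClosed_compl
  have hdisj : Disjoint (Subtype.val '' Vᶜ ∪ (ball x ρ)ᶜ) (Subtype.val '' V : Set X) := by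
    rw [disjoint_left]
    rintro _ (⟨p, hp, rfl⟩ | hp) ⟨q, hq, hqp⟩
    · exact hp (Subtype.ext hqp ▸ hq)
    · rw [← hqp] at hp
      exact hp (hVW hq).2
  obtain ⟨τ, hτ0, hτ1, hτ⟩ := exists_continuous_zero_one_of_isClosed
    (hV2.union isOpen_ball.isClosed_compl) hV1 hdisj
  refine ⟨τ, hτ, by rw [hτ1 ⟨x₀, hxV, rfl⟩]; simp, fun p hp => ?_⟩
  have hpD : p ∉ Subtype.val '' Vᶜ ∪ (ball x ρ)ᶜ := fun h => hp (hτ0 h)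
  rw [mem_union, not_or, notMem_compl_iff] at hpD
  refine ⟨hpD.2, fun heq => ?_⟩
  have hpG : p ∈ G := by
    rw [hG, mem_preimage, segment_eq_image']
    refine ⟨τ p, hτ p, ?_⟩
    simp only
    rw [← sub_eq_zero] at heq ⊢
    rw [← neg_eq_zero, ← heq]
    module
  have hpV : (⟨p, hpG⟩ : G) ∈ V := by
    by_contra h
    exact hpD.1 ⟨⟨p, hpG⟩, h, rfl⟩
  have h1 : τ p = 1 := hτ1 ⟨_, hpV, rfl⟩
  refine (hVW hpV).1 ?_
  rw [h1, one_smul] at heq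
  have : g p - z = 0 := by
    rw [← sub_eq_zero] at heq; rw [← heq]; abel
  exact sub_eq_zero.1 this

/-- A stable value with a finite separated fibre has a fibre point which persists along
segments with short preimage. -/
theorem exists_persistent_fiber_point {g : X → E} (hg : Continuous g) {y : E} {ε ρ : ℝ}
    (hε : 0 < ε)
    (hstable : ∀ f : X → E, Continuous f → (∀ p, dist (f p) (g p) < ε) → ∃ p, f p = y)
    (hfin : (g ⁻¹' {y}).Finite)
    (hsep : ∀ p q, g p = y → g q = y → p ≠ q → 2 * ρ ≤ dist p q) :
    ∃ x, g x = y ∧ ∀ z, dist z y < ε → μH[1] (g ⁻¹' segment ℝ y z) < ENNReal.ofReal ρ →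
      ∃ x', g x' = z ∧ edist x x' ≤ μH[1] (g ⁻¹' segment ℝ y z) := by
  classical
  by_contra! hcon
  have hpush : ∀ x : X, ∃ (z : E) (τ : C(X, ℝ)), dist z y < ε ∧ (∀ p, τ p ∈ Icc (0 : ℝ) 1) ∧
      (g x = y → τ x ≠ 0 ∧ ∀ p, τ p ≠ 0 → dist p x < ρ ∧ g p + τ p • (y - z) ≠ y) := by
    intro x
    by_cases hx : g x = y
    · obtain ⟨z, hz, hlt, hno⟩ := hcon x hx
      subst hx
      rcases exists_fiber_point_or_exists_push hg x z hlt with ⟨x', hx', hle⟩ | ⟨τ, h1, h2, h3⟩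
      · exact absurd (hno x' hx') (not_lt.2 hle)
      · exact ⟨z, τ, hz, h1, fun _ => ⟨h2, h3⟩⟩
    · exact ⟨y, 0, by simpa using hε, by simp, fun h => absurd h hx⟩
  choose z τ hz hτ hpush using hpush
  set F := hfin.toFinset with hF
  have hmem : ∀ x, x ∈ F ↔ g x = y := fun x => by simp [hF]
  let f : X → E := fun p => g p + ∑ x ∈ F, τ x p • (y - z x)
  have hf : Continuous f := by fun_prop
  have hsingle : ∀ x ∈ F, ∀ p, τ x p ≠ 0 → f p = g p + τ x p • (y - z x) := by
    intro x hx p hp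
    simp only [f]
    rw [Finset.sum_eq_single_of_mem x hx]
    intro x' hx' hne
    by_contra h
    have h0 : τ x' p ≠ 0 := fun h0 => h (by rw [h0, zero_smul])
    have h1 := ((hpush x ((hmem x).1 hx)).2 p hp).1
    have h2 := ((hpush x' ((hmem x').1 hx')).2 p h0).1
    have h3 := hsep x' x ((hmem x').1 hx') ((hmem x).1 hx) hne
    have h4 := dist_triangle_left x' x p
    linarith
  have hzero : ∀ p, (∀ x ∈ F, τ x p = 0) → f p = g p := by
    intro p hp
    simp only [f]
    rw [Finset.sum_eq_zero fun x hx => by rw [hp x hx, zero_smul], add_zero]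
  obtain ⟨p, hp⟩ := hstable f hf (fun p => by
    by_cases h : ∃ x ∈ F, τ x p ≠ 0
    · obtain ⟨x, hx, hxp⟩ := h
      rw [hsingle x hx p hxp, dist_eq_norm, add_sub_cancel_left, norm_smul,
        Real.norm_of_nonneg (hτ x p).1]
      refine lt_of_le_of_lt (mul_le_of_le_one_left (norm_nonneg _) (hτ x p).2) ?_
      rw [← dist_eq_norm, dist_comm]
      exact hz x
    · push Not at h
      rw [hzero p h, dist_self]; exact hε)
  by_cases h : ∃ x ∈ F, τ x p ≠ 0
  · obtain ⟨x, hx, hxp⟩ := h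
    rw [hsingle x hx p hxp] at hp
    exact ((hpush x ((hmem x).1 hx)).2 p hxp).2 hp
  · push Not at h
    rw [hzero p h] at hp
    exact (hpush p hp).1 (h p ((hmem p).2 hp))

end Stable

/-- In a compact purely unrectifiable space, a Lipschitz map to `ℝ^n` has null image on every set
where it does not contract distances too much. -/
theorem hausdorffMeasure_image_eq_zero_of_dist_le {X : Type*} [MetricSpace X]
    [MeasurableSpace X] [BorelSpace X] [CompactSpace X] {n : ℕ}
    (hunrect : ∀ E : Set X, IsRectifiableSet n E → μH[n] E = 0)
    {g : X → EuclideanSpace ℝ (Fin n)} {K : ℝ≥0} (hg : LipschitzWith K g) {P : Set X} {C : ℝ}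
    (hP : ∀ x ∈ P, ∀ x' ∈ P, dist x x' ≤ C * dist (g x) (g x')) : μH[n] (g '' P) = 0 := by
  rcases P.eq_empty_or_nonempty with rfl | hne
  · simp
  have hcl : ∀ p ∈ closure P ×ˢ closure P, dist p.1 p.2 ≤ C * dist (g p.1) (g p.2) := by
    have hgc := hg.continuous
    have hclosed : IsClosed {p : X × X | dist p.1 p.2 ≤ C * dist (g p.1) (g p.2)} :=
      isClosed_le (by fun_prop) (by fun_prop)
    rw [← closure_prod_eq]
    exact hclosed.closure_subset_iff.2 fun p hp => hP _ hp.1 _ hp.2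
  have hcl' : ∀ x ∈ closure P, ∀ x' ∈ closure P, dist x x' ≤ C * dist (g x) (g x') :=
    fun x hx x' hx' => hcl (x, x') ⟨hx, hx'⟩
  have hrect : IsRectifiableSet n (closure P) := by
    have := hne.to_type
    refine ⟨isClosed_closure.measurableSet, fun _ => g '' closure P,
      fun _ => Function.invFunOn g (closure P), fun _ =>
        (isClosed_closure.isCompact.image hg.continuous).measurableSet, fun _ => ?_, ?_⟩
    · refine ⟨C.toNNReal, LipschitzOnWith.of_dist_le_mul fun y hy y' hy' => ?_⟩
      have h := hcl' _ (Function.invFunOn_mem hy) _ (Function.invFunOn_mem hy')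
      rw [Function.invFunOn_eq hy, Function.invFunOn_eq hy'] at h
      exact h.trans (mul_le_mul_of_nonneg_right (Real.le_coe_toNNReal C) dist_nonneg)
    · rw [sdiff_eq_empty.2, measure_empty]
      intro x hx
      refine mem_iUnion.2 ⟨0, g x, ⟨x, hx, rfl⟩, ?_⟩
      have hgx : ∃ a ∈ closure P, g a = g x := ⟨x, hx, rfl⟩
      have h := hcl' _ (Function.invFunOn_mem hgx) x hx
      rw [Function.invFunOn_eq hgx, dist_self, mul_zero] at h
      exact dist_le_zero.1 h
  refine measure_mono_null (image_mono subset_closure) (le_antisymm ?_ zero_le)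
  refine (hg.hausdorffMeasure_image_le n.cast_nonneg _).trans ?_
  rw [hunrect _ hrect, mul_zero]

/-- Almost every point has a uniform upper density bound at small scales for a finite measure. -/
theorem ae_exists_measure_closedBall_le {E : Type*} [NormedAddCommGroup E] [NormedSpace ℝ E]
    [FiniteDimensional ℝ E] [MeasurableSpace E] [BorelSpace E] (ν : Measure E)
    [ν.IsAddHaarMeasure] {n : ℕ} (hn : Module.finrank ℝ E = n) (μ : Measure E)
    [IsFiniteMeasure μ] :
    ∀ᵐ y ∂ν, ∃ k : ℕ, ∀ s ∈ Ioc (0 : ℝ) (1 / (k + 1)),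
      μ (closedBall y s) ≤ ENNReal.ofReal (k * s ^ n) := by
  filter_upwards [Besicovitch.ae_tendsto_rnDeriv μ ν, μ.rnDeriv_lt_top ν] with y hy hlt
  have hV : ν (ball (0 : E) 1) ≠ ∞ := measure_ball_lt_top.ne
  obtain ⟨b, hb1, hb2⟩ := exists_between hlt
  have hev := hy.eventually_le_const hb1
  rw [eventually_nhdsWithin_iff, Metric.eventually_nhds_iff] at hev
  obtain ⟨δ, hδ, hev⟩ := hev
  obtain ⟨k₁, hk₁⟩ := exists_nat_one_div_lt hδ
  obtain ⟨k₂, hk₂⟩ := exists_nat_ge (b * ν (ball (0 : E) 1)).toReal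
  refine ⟨max k₁ k₂, fun s hs => ?_⟩
  have hsδ : s < δ := by
    refine (hs.2.trans ?_).trans_lt hk₁
    gcongr
    exact le_max_left _ _
  have h := hev (y := s) (by rw [dist_zero_right, Real.norm_of_nonneg hs.1.le]; exact hsδ) hs.1
  have hpos : ν (closedBall y s) ≠ 0 := (measure_closedBall_pos ν y hs.1).ne'
  rw [ENNReal.div_le_iff hpos measure_closedBall_lt_top.ne, Measure.addHaar_closedBall ν y hs.1.le,
    hn, mul_left_comm] at h
  refine h.trans ?_
  rw [mul_comm, ENNReal.ofReal_mul (Nat.cast_nonneg _)]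
  gcongr
  rw [← ENNReal.ofReal_toReal (ENNReal.mul_ne_top hb2.ne hV)]
  refine ENNReal.ofReal_le_ofReal (hk₂.trans ?_)
  exact_mod_cast le_max_right k₁ k₂

/-- Up to a null set, an arbitrary set is a countable union of subsets with uniform density. -/
theorem measure_eq_zero_of_forall_uniform_density {E : Type*} [NormedAddCommGroup E]
    [NormedSpace ℝ E] [FiniteDimensional ℝ E] [MeasurableSpace E] [BorelSpace E] (ν : Measure E)
    [ν.IsAddHaarMeasure] (Y : Set E)
    (h : ∀ δ : ℝ, 0 < δ → ν {y ∈ Y | ∀ r ∈ Ioc 0 δ,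
      ν (closedBall y r) ≤ 2 * ν (Y ∩ closedBall y r)} = 0) : ν Y = 0 := by
  have hae := Besicovitch.ae_tendsto_measure_inter_div ν Y
  set N := {y | ¬ Tendsto (fun r => ν (Y ∩ closedBall y r) / ν (closedBall y r)) (𝓝[>] 0) (𝓝 1)}
  have hN : ν (N ∩ Y) = 0 := le_antisymm ((Measure.le_restrict_apply _ _).trans hae.le) zero_le
  have hsub : Y ⊆ (N ∩ Y) ∪ ⋃ j : ℕ, {y ∈ Y | ∀ r ∈ Ioc (0 : ℝ) (1 / (j + 1)),
      ν (closedBall y r) ≤ 2 * ν (Y ∩ closedBall y r)} := by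
    intro y hy
    by_cases hyN : y ∈ N
    · exact Or.inl ⟨hyN, hy⟩
    right
    have hev := (not_not.1 hyN).eventually_const_le
      (show (1 / 2 : ℝ≥0∞) < 1 by norm_num)
    rw [eventually_nhdsWithin_iff, Metric.eventually_nhds_iff] at hev
    obtain ⟨δ, hδ, hev⟩ := hev
    obtain ⟨j, hj⟩ := exists_nat_one_div_lt hδ
    refine mem_iUnion.2 ⟨j, hy, fun r hr => ?_⟩
    have h := hev (y := r) (by
      rw [dist_zero_right, Real.norm_of_nonneg hr.1.le]; exact hr.2.trans_lt hj) hr.1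
    have hpos : ν (closedBall y r) ≠ 0 := (measure_closedBall_pos ν y hr.1).ne'
    rw [ENNReal.le_div_iff_mul_le (Or.inl hpos) (Or.inl measure_closedBall_lt_top.ne)] at h
    calc ν (closedBall y r) = 2 * (1 / 2 * ν (closedBall y r)) := by
          rw [← mul_assoc, one_div, ENNReal.mul_inv_cancel (by norm_num) (by norm_num), one_mul]
      _ ≤ _ := by gcongr
  refine measure_mono_null hsub (measure_union_null hN (measure_iUnion_null fun j => h _ ?_))
  positivity

/-- A set of persistent fibre points with uniform constants has null image. -/
theorem hausdorffMeasure_image_eq_zero_of_persistent {X : Type*} [MetricSpace X]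
    [MeasurableSpace X] [BorelSpace X] [CompactSpace X] {m : ℕ}
    (hunrect : ∀ E : Set X, IsRectifiableSet (m + 1) E → μH[(m + 1 : ℕ)] E = 0)
    {g : X → EuclideanSpace ℝ (Fin (m + 1))} {K : ℝ≥0} (hK : 0 < K) (hg : LipschitzWith K g)
    {P : Set X} {ε ρ Λ R : ℝ} (hε : 0 < ε) (hρ : 0 < ρ) (hΛ : 0 ≤ Λ) (hR : 0 < R)
    (hPfin : ∀ x ∈ P, (g ⁻¹' {g x}).Finite)
    (hPsep : ∀ x ∈ P, ∀ p q, g p = g x → g q = g x → p ≠ q → 2 * ρ ≤ dist p q)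
    (hPdens : ∀ x ∈ P, ∀ s ∈ Ioc 0 R,
      μH[(m + 1 : ℕ)] (g ⁻¹' closedBall (g x) s) ≤ ENNReal.ofReal (Λ * s ^ (m + 1)))
    (hPpers : ∀ x ∈ P, ∀ z, dist z (g x) < ε →
      μH[1] (g ⁻¹' segment ℝ (g x) z) < ENNReal.ofReal ρ →
      ∃ x', g x' = z ∧ edist x x' ≤ μH[1] (g ⁻¹' segment ℝ (g x) z))
    (hPdiam : ∀ x ∈ P, ∀ x' ∈ P, dist x x' < ρ) :
    μH[(m + 1 : ℕ)] (g '' P) = 0 := by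
  set ν : Measure (EuclideanSpace ℝ (Fin (m + 1))) := μH[(m + 1 : ℕ)] with hν
  refine measure_eq_zero_of_forall_uniform_density ν _ fun δ hδ => ?_
  set Y := g '' P with hY
  set Y' := {y ∈ Y | ∀ r ∈ Ioc 0 δ, ν (closedBall y r) ≤ 2 * ν (Y ∩ closedBall y r)} with hY'
  have hfr : Module.finrank ℝ (EuclideanSpace ℝ (Fin (m + 1))) = m + 1 := by simp
  obtain ⟨T, hT, hseg⟩ := exists_segment_length_bound ν hfr hK hg hΛ
    (θ := 1 / (8 * 2 ^ (m + 1))) (by positivity)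
  obtain ⟨r₀, hr₀, hr₀δ, hr₀R, hr₀ε, hr₀T⟩ : ∃ r₀ : ℝ, 0 < r₀ ∧ r₀ ≤ δ ∧ 2 * r₀ ≤ R ∧
      2 * r₀ < ε ∧ 3 * T * r₀ < ρ := by
    refine ⟨min (min δ (R / 2)) (min (ε / 4) (ρ / (6 * T))), by positivity, ?_, ?_, ?_, ?_⟩
    · exact (min_le_left _ _).trans (min_le_left _ _)
    · have := (min_le_left (min δ (R / 2)) (min (ε / 4) (ρ / (6 * T)))).trans (min_le_right _ _)
      linarith
    · have := (min_le_right (min δ (R / 2)) (min (ε / 4) (ρ / (6 * T)))).trans (min_le_left _ _)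
      linarith
    · have := (min_le_right (min δ (R / 2)) (min (ε / 4) (ρ / (6 * T)))).trans (min_le_right _ _)
      rw [le_div_iff₀ (by positivity)] at this
      linarith
  have hY'eq : Y' = g '' (P ∩ g ⁻¹' Y') := by
    rw [image_inter_preimage, inter_eq_right.2 (sep_subset _ _)]
  rw [hY'eq]
  refine hausdorffMeasure_image_eq_zero_of_dist_le hunrect hg (C := max (3 * T) (ρ / r₀)) ?_
  rintro x₁ ⟨hx₁, hy₁⟩ x₂ ⟨hx₂, -⟩
  have hdiam := hPdiam x₁ hx₁ x₂ hx₂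
  set r := dist (g x₁) (g x₂) with hr
  have hrnn : 0 ≤ r := dist_nonneg
  rcases hrnn.eq_or_lt with hr0 | hr0
  · have hgx : g x₁ = g x₂ := dist_eq_zero.1 (hr.symm.trans hr0.symm)
    have : x₁ = x₂ := by
      by_contra hne
      have := hPsep x₂ hx₂ x₁ x₂ hgx rfl hne
      linarith
    rw [this, dist_self, ← hr0, mul_zero]
  rcases lt_or_ge r₀ r with hrr | hrr
  · calc dist x₁ x₂ ≤ ρ := hdiam.le
      _ = ρ / r₀ * r₀ := by field_simp
      _ ≤ max (3 * T) (ρ / r₀) * r := by gcongr; exact le_max_right _ _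
  have hbad₁ := hseg (g x₁) R (hPfin x₁ hx₁) (hPdens x₁ hx₁) r ⟨hr0, by linarith⟩
  have hbad₂ := hseg (g x₂) R (hPfin x₂ hx₂) (hPdens x₂ hx₂) (2 * r) ⟨by linarith, by linarith⟩
  set B₁ := {z | dist z (g x₁) ≤ r ∧ ENNReal.ofReal (T * r) < μH[1] (g ⁻¹' segment ℝ (g x₁) z)}
  set B₂ := {z | dist z (g x₂) ≤ 2 * r ∧
    ENNReal.ofReal (T * (2 * r)) < μH[1] (g ⁻¹' segment ℝ (g x₂) z)}
  obtain ⟨z, ⟨hzY, hz₁⟩, hzB⟩ : ∃ z ∈ Y ∩ closedBall (g x₁) r, z ∉ B₁ ∪ B₂ := by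
    by_contra! hsub
    have hV0 : ν (ball 0 1) ≠ 0 := (measure_ball_pos ν _ one_pos).ne'
    have hV : ν (ball 0 1) ≠ ∞ := measure_ball_lt_top.ne
    have h1 := hy₁.2 r ⟨hr0, by linarith⟩
    have h2 := (measure_mono (μ := ν) hsub).trans ((measure_union_le _ _).trans
      (add_le_add hbad₁ hbad₂))
    rw [← add_mul, ← ENNReal.ofReal_add (by positivity) (by positivity)] at h2
    have h3 := h1.trans (mul_le_mul' le_rfl h2)
    rw [Measure.addHaar_closedBall ν _ hr0.le, hfr, ← mul_assoc,
      ENNReal.mul_le_mul_iff_left hV0 hV, ← ENNReal.ofReal_ofNat, ← ENNReal.ofReal_mul (by norm_num),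
      ENNReal.ofReal_le_ofReal_iff (by positivity), mul_pow] at h3
    have h4 : (1 : ℝ) ≤ 2 ^ (m + 1) := one_le_pow₀ (by norm_num)
    have h5 : 0 < r ^ (m + 1) := by positivity
    have h6 : 2 * (1 / (8 * 2 ^ (m + 1)) * r ^ (m + 1) +
        1 / (8 * 2 ^ (m + 1)) * (2 ^ (m + 1) * r ^ (m + 1))) =
        (1 / (4 * 2 ^ (m + 1)) + 1 / 4) * r ^ (m + 1) := by
      field_simp; ring
    have h7 : (1 : ℝ) / (4 * 2 ^ (m + 1)) ≤ 1 / 4 := by gcongr; linarith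
    rw [h6] at h3
    nlinarith
  have hz₂ : dist z (g x₂) ≤ 2 * r := by
    have := dist_triangle z (g x₁) (g x₂)
    have := mem_closedBall.1 hz₁
    linarith
  have hl₁ : μH[1] (g ⁻¹' segment ℝ (g x₁) z) ≤ ENNReal.ofReal (T * r) :=
    not_lt.1 fun h => hzB (Or.inl ⟨hz₁, h⟩)
  have hl₂ : μH[1] (g ⁻¹' segment ℝ (g x₂) z) ≤ ENNReal.ofReal (T * (2 * r)) :=
    not_lt.1 fun h => hzB (Or.inr ⟨hz₂, h⟩)
  have hTr : T * r ≤ T * r₀ := by gcongr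
  have hTr0 : 0 < T * r := by positivity
  obtain ⟨x₁', hx₁', hd₁⟩ := hPpers x₁ hx₁ z (by have := mem_closedBall.1 hz₁; linarith)
    (hl₁.trans_lt ((ENNReal.ofReal_lt_ofReal_iff hρ).2 (by linarith)))
  obtain ⟨x₂', hx₂', hd₂⟩ := hPpers x₂ hx₂ z (by linarith)
    (hl₂.trans_lt ((ENNReal.ofReal_lt_ofReal_iff hρ).2 (by linarith)))
  replace hd₁ := hd₁.trans hl₁
  replace hd₂ := hd₂.trans hl₂
  rw [edist_dist, ENNReal.ofReal_le_ofReal_iff (by positivity)] at hd₁ hd₂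
  obtain ⟨w, hw, rfl⟩ := hzY
  have htri := dist_triangle4 x₁' x₁ x₂ x₂'
  rw [dist_comm x₁' x₁] at htri
  have heq : x₁' = x₂' := by
    by_contra hne
    have := hPsep w hw x₁' x₂' hx₁' hx₂' hne
    linarith
  subst heq
  calc dist x₁ x₂ ≤ dist x₁ x₁' + dist x₂ x₁' := dist_triangle_right _ _ _
    _ ≤ 3 * T * r := by linarith
    _ ≤ max (3 * T) (ρ / r₀) * r := by gcongr; exact le_max_left _ _

/-- In a compact purely unrectifiable space of finite measure, no value of a Lipschitz map to
`ℝ^n` is stable under small perturbations. -/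
theorem exists_continuous_avoiding {X : Type*} [MetricSpace X]
    [MeasurableSpace X] [BorelSpace X] [CompactSpace X] {m : ℕ}
    (hunrect : ∀ E : Set X, IsRectifiableSet (m + 1) E → μH[(m + 1 : ℕ)] E = 0)
    (hfin : μH[(m + 1 : ℕ)] (univ : Set X) ≠ ∞)
    {g : X → EuclideanSpace ℝ (Fin (m + 1))} {K : ℝ≥0} (hg : LipschitzWith K g)
    (y₀ : EuclideanSpace ℝ (Fin (m + 1))) {ε : ℝ} (hε : 0 < ε) :
    ∃ f : X → EuclideanSpace ℝ (Fin (m + 1)), Continuous f ∧ (∀ p, dist (f p) (g p) < ε) ∧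
      ∀ p, f p ≠ y₀ := by
  by_contra! hcon
  obtain ⟨p₀, -⟩ := hcon g hg.continuous fun p => by simpa using hε
  have : Nonempty X := ⟨p₀⟩
  have hg' : LipschitzWith (K + 1) g := hg.weaken le_self_add
  set ν : Measure (EuclideanSpace ℝ (Fin (m + 1))) := μH[(m + 1 : ℕ)] with hν
  have hfr : Module.finrank ℝ (EuclideanSpace ℝ (Fin (m + 1))) = m + 1 := by simp
  have hfinm : IsFiniteMeasure (μH[(m + 1 : ℕ)] : Measure X) := ⟨hfin.lt_top⟩
  have hstable : ∀ y ∈ ball y₀ (ε / 2), ∀ f : X → EuclideanSpace ℝ (Fin (m + 1)), Continuous f →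
      (∀ p, dist (f p) (g p) < ε / 2) → ∃ p, f p = y := by
    intro y hy f hf hfg
    obtain ⟨p, hp⟩ := hcon (fun p => f p + (y₀ - y)) (by fun_prop) fun p => by
      calc dist (f p + (y₀ - y)) (g p) ≤ dist (f p + (y₀ - y)) (f p) + dist (f p) (g p) :=
            dist_triangle _ _ _
        _ < ε / 2 + ε / 2 := by
            refine add_lt_add ?_ (hfg p)
            rw [dist_self_add_left, ← dist_eq_norm, dist_comm]
            exact hy
        _ = ε := add_halves ε
    exact ⟨p, by rw [← sub_eq_zero] at hp ⊢; rw [← hp]; abel⟩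
  let P : ℕ → ℕ → ℕ → Set X := fun k l j => {x |
    dist x (TopologicalSpace.denseSeq X l) < 1 / (k + 1 : ℝ) / 2 ∧
    (g ⁻¹' {g x}).Finite ∧
    (∀ p q, g p = g x → g q = g x → p ≠ q → 2 * (1 / (k + 1 : ℝ)) ≤ dist p q) ∧
    (∀ s ∈ Ioc (0 : ℝ) (1 / (j + 1)), μH[(m + 1 : ℕ)] (g ⁻¹' closedBall (g x) s) ≤
      ENNReal.ofReal (j * s ^ (m + 1))) ∧
    ∀ z, dist z (g x) < ε / 2 →
      μH[1] (g ⁻¹' segment ℝ (g x) z) < ENNReal.ofReal (1 / (k + 1 : ℝ)) →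
      ∃ x', g x' = z ∧ edist x x' ≤ μH[1] (g ⁻¹' segment ℝ (g x) z)}
  have hP : ∀ k l j, ν (g '' P k l j) = 0 := fun k l j =>
    hausdorffMeasure_image_eq_zero_of_persistent hunrect (by positivity) hg'
      (ε := ε / 2) (ρ := 1 / (k + 1)) (Λ := j) (R := 1 / (j + 1)) (by positivity) (by positivity)
      (by positivity) (by positivity) (fun x hx => hx.2.1) (fun x hx => hx.2.2.1)
      (fun x hx => hx.2.2.2.1) (fun x hx => hx.2.2.2.2) fun x hx x' hx' => by
        have := dist_triangle_right x x' (TopologicalSpace.denseSeq X l)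
        have h1 := hx.1
        have h2 := hx'.1
        linarith
  have hae : ∀ᵐ y ∂ν, y ∈ ball y₀ (ε / 2) → y ∈ ⋃ (k) (l) (j), g '' P k l j := by
    filter_upwards [ae_finite_fiber ν hfr hg hfin,
      ae_exists_measure_closedBall_le ν hfr (Measure.map g μH[(m + 1 : ℕ)])] with y hyfin hydens hy
    obtain ⟨j, hj⟩ := hydens
    obtain ⟨k, hk⟩ : ∃ k : ℕ, ∀ p q, g p = y → g q = y → p ≠ q →
        2 * (1 / (k + 1 : ℝ)) ≤ dist p q := by
      obtain ⟨δ, hδ, hsep⟩ : ∃ δ > 0, ∀ p ∈ g ⁻¹' {y}, ∀ q ∈ g ⁻¹' {y}, p ≠ q → δ ≤ dist p q := by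
        obtain ⟨C, hC, hsep⟩ := hyfin.relatively_discrete
        refine ⟨(min C 1).toReal, ENNReal.toReal_pos (lt_min hC one_pos).ne'
          (min_lt_of_right_lt ENNReal.one_lt_top).ne, fun p hp q hq hne => ?_⟩
        rw [dist_edist]
        exact ENNReal.toReal_mono (edist_ne_top _ _) ((min_le_left _ _).trans (hsep p hp q hq hne))
      obtain ⟨k, hk⟩ := exists_nat_one_div_lt (half_pos hδ)
      exact ⟨k, fun p q hp hq hne => by linarith [hsep p hp q hq hne]⟩
    obtain ⟨x, rfl, hx⟩ := exists_persistent_fiber_point hg.continuous (half_pos hε)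
      (hstable y hy) hyfin hk
    obtain ⟨l, hl⟩ := (TopologicalSpace.denseRange_denseSeq X).exists_dist_lt x
      (show 0 < 1 / (k + 1 : ℝ) / 2 by positivity)
    refine mem_iUnion.2 ⟨k, mem_iUnion.2 ⟨l, mem_iUnion.2 ⟨j, x, ⟨hl, hyfin, hk, fun s hs => ?_,
      hx⟩, rfl⟩⟩⟩
    rw [← Measure.map_apply hg.continuous.measurable measurableSet_closedBall]
    exact hj s hs
  have hnull : ν (⋃ (k) (l) (j), g '' P k l j) = 0 := by simp [measure_iUnion_null_iff, hP]
  refine (measure_ball_pos ν y₀ (half_pos hε)).ne' (le_antisymm ?_ zero_le)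
  exact (measure_mono_ae hae).trans hnull.le

section Density

variable {X : Type*} [MetricSpace X] [CompactSpace X]

/-- Lipschitz functions are dense among the continuous real functions on a compact metric space. -/
theorem exists_lipschitzWith_abs_sub_lt (g : C(X, ℝ)) {ε : ℝ} (hε : 0 < ε) :
    ∃ f : X → ℝ, (∃ K : ℝ≥0, LipschitzWith K f) ∧ ∀ x, |f x - g x| < ε := by
  have hcl : closure {f : C(X, ℝ) | ∃ K : ℝ≥0, LipschitzWith K f} = ⊤ := by
    refine ContinuousMap.sublattice_closure_eq_top _ ⟨0, 0, LipschitzWith.const 0⟩ ?_ ?_ ?_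
    · rintro f ⟨K, hf⟩ f' ⟨K', hf'⟩
      exact ⟨_, hf.min hf'⟩
    · rintro f ⟨K, hf⟩ f' ⟨K', hf'⟩
      exact ⟨_, hf.max hf'⟩
    · intro v x y
      set c := (v y - v x) / dist x y with hc
      have hlip : LipschitzWith (Real.nnabs c) fun z => v x + c * dist x z := by
        refine LipschitzWith.of_dist_le_mul fun z z' => ?_
        rw [dist_add_left, Real.dist_eq, ← mul_sub, abs_mul, Real.coe_nnabs]
        refine mul_le_mul_of_nonneg_left ?_ (abs_nonneg _)
        simpa [Real.dist_eq] using (LipschitzWith.dist_right x).dist_le_mul z z'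
      refine ⟨⟨_, hlip.continuous⟩, ⟨_, hlip⟩, by simp, ?_⟩
      rcases eq_or_ne x y with rfl | hxy
      · simp
      · have := dist_ne_zero.2 hxy
        simp only [ContinuousMap.coe_mk, hc]
        field_simp
        ring
  have hg : g ∈ closure {f : C(X, ℝ) | ∃ K : ℝ≥0, LipschitzWith K f} := by rw [hcl]; trivial
  obtain ⟨f, hf, hfg⟩ := Metric.mem_closure_iff.1 hg ε hε
  refine ⟨f, hf, fun x => ?_⟩
  rw [abs_sub_comm, ← Real.dist_eq]
  exact (ContinuousMap.dist_apply_le_dist x).trans_lt hfg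

/-- Lipschitz maps are dense among the continuous maps from a compact metric space to `ℝ^n`. -/
theorem exists_lipschitzWith_dist_lt {n : ℕ} {g : X → EuclideanSpace ℝ (Fin n)}
    (hg : Continuous g) {ε : ℝ} (hε : 0 < ε) :
    ∃ f : X → EuclideanSpace ℝ (Fin n), (∃ K : ℝ≥0, LipschitzWith K f) ∧
      ∀ x, dist (f x) (g x) < ε := by
  have hL := PiLp.lipschitzWith_toLp 2 (fun _ : Fin n => ℝ)
  set L : ℝ≥0 := (Fintype.card (Fin n) : ℝ≥0) ^ (1 / (2 : ℝ≥0∞)).toReal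
  have hcoord := fun i : Fin n => exists_lipschitzWith_abs_sub_lt
    (⟨fun x => g x i, by fun_prop⟩ : C(X, ℝ)) (show 0 < ε / (L + 1) by positivity)
  choose f hf hfg using hcoord
  choose K hK using hf
  have hpi : LipschitzWith (∑ i, K i) fun x i => f i x :=
    LipschitzWith.of_dist_le_mul fun x y => (dist_pi_le_iff (by positivity)).2 fun i =>
      ((hK i).dist_le_mul x y).trans (mul_le_mul_of_nonneg_right
        (NNReal.coe_le_coe.2 (Finset.single_le_sum (fun _ _ => zero_le) (Finset.mem_univ i)))
        dist_nonneg)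
  refine ⟨fun x => WithLp.toLp 2 fun i => f i x, ⟨_, hL.comp hpi⟩, fun x => ?_⟩
  have h1 : dist (fun i => f i x) (WithLp.ofLp (g x)) ≤ ε / (L + 1) :=
    (dist_pi_le_iff (by positivity)).2 fun i => (hfg i x).le
  calc dist (WithLp.toLp 2 fun i => f i x) (g x)
      ≤ L * dist (fun i => f i x) (WithLp.ofLp (g x)) := hL.dist_le_mul _ (WithLp.ofLp (g x))
    _ ≤ L * (ε / (L + 1)) := by gcongr
    _ < ε := by
      rw [← mul_div_assoc, div_lt_iff₀ (by positivity)]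
      nlinarith

end Density

/-- In a compact purely unrectifiable space of finite measure, every continuous map to `ℝ^n` is
approximated by Lipschitz maps staying away from a given countable closed set. -/
theorem exists_lipschitzWith_away_from_countable {X : Type*} [MetricSpace X]
    [MeasurableSpace X] [BorelSpace X] [CompactSpace X] {m : ℕ}
    (hunrect : ∀ E : Set X, IsRectifiableSet (m + 1) E → μH[(m + 1 : ℕ)] E = 0)
    (hfin : μH[(m + 1 : ℕ)] (univ : Set X) ≠ ∞)
    {g : X → EuclideanSpace ℝ (Fin (m + 1))} (hg : Continuous g)
    {S : Set (EuclideanSpace ℝ (Fin (m + 1)))} (hSc : S.Countable) (hS : IsClosed S)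
    {ε : ℝ} (hε : 0 < ε) :
    ∃ f : X → EuclideanSpace ℝ (Fin (m + 1)), (∃ K : ℝ≥0, LipschitzWith K f) ∧
      (∀ x, dist (f x) (g x) < ε) ∧ ∃ δ > 0, ∀ x, ∀ s ∈ S, δ ≤ dist (f x) s := by
  have := hSc.to_subtype
  have hdense : Dense (⋂ s : S, {f : C(X, EuclideanSpace ℝ (Fin (m + 1))) |
      MapsTo f univ {(s : EuclideanSpace ℝ (Fin (m + 1)))}ᶜ}) := by
    refine dense_iInter_of_isOpen
      (fun s => ContinuousMap.isOpen_setOfPred_mapsTo isCompact_univ isOpen_compl_singleton)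
      fun s => Metric.dense_iff.2 fun f r hr => ?_
    obtain ⟨f₁, ⟨K, hK⟩, hf₁⟩ := exists_lipschitzWith_dist_lt f.continuous (half_pos hr)
    obtain ⟨f₂, hf₂c, hf₂, hav⟩ := exists_continuous_avoiding hunrect hfin hK s (half_pos hr)
    refine ⟨⟨f₂, hf₂c⟩, mem_ball.2 ((ContinuousMap.dist_lt_iff hr).2 fun x => ?_),
      fun x _ => hav x⟩
    have := dist_triangle (f₂ x) (f₁ x) (f x)
    have := hf₁ x
    have := hf₂ x
    simp only [ContinuousMap.coe_mk]
    linarith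
  obtain ⟨f₁, hf₁, hf₁g⟩ := hdense.exists_dist_lt ⟨g, hg⟩ (half_pos hε)
  have hdisj : Disjoint (range f₁) S := by
    rw [disjoint_left]
    rintro _ ⟨x, rfl⟩ hx
    exact mem_iInter.1 hf₁ ⟨f₁ x, hx⟩ (mem_univ x) rfl
  obtain ⟨δ, hδ, hsep⟩ := exists_pos_forall_lt_edist (isCompact_range f₁.continuous) hS hdisj
  obtain ⟨f, hf, hff⟩ := exists_lipschitzWith_dist_lt f₁.continuous
    (show 0 < min (ε / 2) (δ / 2) by positivity)
  refine ⟨f, hf, fun x => ?_, δ / 2, by positivity, fun x s hs => ?_⟩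
  · have h1 := (hff x).trans_le (min_le_left _ _)
    have h2 := (ContinuousMap.dist_lt_iff (half_pos hε)).1 hf₁g x
    rw [ContinuousMap.coe_mk, dist_comm] at h2
    linarith [dist_triangle (f x) (f₁ x) (g x)]
  · have h1 := (hff x).trans_le (min_le_right _ _)
    have h2 := hsep _ (mem_range_self x) s hs
    rw [edist_nndist, ENNReal.coe_lt_coe, ← NNReal.coe_lt_coe, coe_nndist] at h2
    linarith [dist_triangle_left (f₁ x) s (f x)]

section Skeleton

variable {ι : Type*} [Fintype ι]

/-- The centre of the unit lattice cube containing `u`. -/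
noncomputable def cubeCenter (u : ι → ℝ) : ι → ℝ := fun i => ⌊u i⌋ + 1 / 2

/-- The radial projection of a unit lattice cube onto its boundary, from its centre. -/
noncomputable def cubeProjection (u : ι → ℝ) : ι → ℝ :=
  cubeCenter u + (1 / (2 * ‖u - cubeCenter u‖)) • (u - cubeCenter u)

theorem abs_sub_floor_add_half_le (t : ℝ) : |t - (⌊t⌋ + 1 / 2)| ≤ 1 / 2 := by
  rw [abs_le]
  constructor <;> linarith [Int.floor_le t, Int.lt_floor_add_one t]

theorem add_half_sub_abs_le_of_floor_lt {s t : ℝ} (h : ⌊s⌋ < ⌊t⌋) :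
    (1 / 2 - |s - (⌊s⌋ + 1 / 2)|) + (1 / 2 - |t - (⌊t⌋ + 1 / 2)|) ≤ |s - t| := by
  have h1 : (⌊s⌋ : ℝ) + 1 ≤ ⌊t⌋ := by exact_mod_cast h
  have h2 := le_abs_self (s - (⌊s⌋ + 1 / 2))
  have h3 := neg_abs_le (t - (⌊t⌋ + 1 / 2))
  have h4 := neg_abs_le (s - t)
  linarith

theorem add_half_sub_abs_le_of_floor_ne {s t : ℝ} (h : ⌊s⌋ ≠ ⌊t⌋) :
    (1 / 2 - |s - (⌊s⌋ + 1 / 2)|) + (1 / 2 - |t - (⌊t⌋ + 1 / 2)|) ≤ |s - t| := by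
  rcases h.lt_or_gt with h | h
  · exact add_half_sub_abs_le_of_floor_lt h
  · rw [add_comm, abs_sub_comm s t]
    exact add_half_sub_abs_le_of_floor_lt h

theorem norm_sub_cubeCenter_le (u : ι → ℝ) : ‖u - cubeCenter u‖ ≤ 1 / 2 :=
  (pi_norm_le_iff_of_nonneg (by norm_num)).2 fun i => abs_sub_floor_add_half_le (u i)

theorem norm_cubeProjection_sub {u : ι → ℝ} (h : 0 < ‖u - cubeCenter u‖) :
    ‖cubeProjection u - u‖ = 1 / 2 - ‖u - cubeCenter u‖ := by
  have hle := norm_sub_cubeCenter_le u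
  have : cubeProjection u - u =
      (1 / (2 * ‖u - cubeCenter u‖) - 1) • (u - cubeCenter u) := by
    rw [cubeProjection]; module
  rw [this, norm_smul, Real.norm_of_nonneg, sub_mul]
  · field_simp
  · rw [sub_nonneg, le_div_iff₀ (by positivity)]
    linarith

theorem exists_cubeProjection_eq_int [Nonempty ι] {u : ι → ℝ} (h : 0 < ‖u - cubeCenter u‖) :
    ∃ i, ∃ k : ℤ, cubeProjection u i = k := by
  set w := u - cubeCenter u with hw
  obtain ⟨i, hmax⟩ := Finite.exists_max fun i => ‖w i‖
  have hi : ‖w i‖ = ‖w‖ :=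
    le_antisymm (norm_le_pi_norm w i) ((pi_norm_le_iff_of_nonneg (norm_nonneg _)).2 hmax)
  refine ⟨i, ?_⟩
  have hP : cubeProjection u i = ⌊u i⌋ + 1 / 2 + 1 / (2 * ‖w‖) * w i := rfl
  rcases abs_choice (w i) with h' | h' <;> rw [Real.norm_eq_abs, h'] at hi
  · refine ⟨⌊u i⌋ + 1, ?_⟩
    rw [hP, hi]
    push_cast
    field_simp
    ring
  · refine ⟨⌊u i⌋, ?_⟩
    rw [hP, ← neg_neg (w i), hi]
    field_simp
    ring

theorem norm_smul_inv_norm_sub_le {V : Type*} [NormedAddCommGroup V] [NormedSpace ℝ V] {v w : V}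
    (hv : 0 < ‖v‖) (hw : 0 < ‖w‖) :
    ‖(1 / (2 * ‖v‖)) • v - (1 / (2 * ‖w‖)) • w‖ ≤ ‖v - w‖ / ‖v‖ := by
  have h : (1 / (2 * ‖v‖)) • v - (1 / (2 * ‖w‖)) • w =
      (1 / (2 * ‖v‖)) • (v - w) + (1 / (2 * ‖v‖) - 1 / (2 * ‖w‖)) • w := by module
  have h2 : |1 / (2 * ‖v‖) - 1 / (2 * ‖w‖)| * ‖w‖ = |‖w‖ - ‖v‖| / (2 * ‖v‖) := by
    have : 1 / (2 * ‖v‖) - 1 / (2 * ‖w‖) = (‖w‖ - ‖v‖) / (2 * ‖v‖ * ‖w‖) := by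
      field_simp
    rw [this, abs_div, abs_of_pos (by positivity : 0 < 2 * ‖v‖ * ‖w‖)]
    field_simp
  rw [h]
  refine (norm_add_le _ _).trans ?_
  rw [norm_smul, norm_smul, Real.norm_of_nonneg (by positivity), Real.norm_eq_abs, h2]
  have h3 : |‖w‖ - ‖v‖| ≤ ‖v - w‖ := by
    rw [norm_sub_rev]; exact abs_norm_sub_norm_le w v
  calc 1 / (2 * ‖v‖) * ‖v - w‖ + |‖w‖ - ‖v‖| / (2 * ‖v‖)
      ≤ 1 / (2 * ‖v‖) * ‖v - w‖ + ‖v - w‖ / (2 * ‖v‖) := by gcongr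
    _ = ‖v - w‖ / ‖v‖ := by field_simp; ring

/-- The cube projection is Lipschitz away from the cube centres. -/
theorem lipschitzOnWith_cubeProjection {η : ℝ≥0} (hη : 0 < η) :
    LipschitzOnWith (η⁻¹ + 2) (cubeProjection (ι := ι)) {u | (η : ℝ) ≤ ‖u - cubeCenter u‖} := by
  refine LipschitzOnWith.of_dist_le_mul fun u hu v hv => ?_
  have hη' : (0 : ℝ) < η := hη
  have hu0 : 0 < ‖u - cubeCenter u‖ := hη'.trans_le hu
  have hv0 : 0 < ‖v - cubeCenter v‖ := hη'.trans_le hv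
  rw [dist_eq_norm, dist_eq_norm]
  push_cast
  by_cases hc : cubeCenter u = cubeCenter v
  · have h1 : cubeProjection u - cubeProjection v =
        (1 / (2 * ‖u - cubeCenter u‖)) • (u - cubeCenter u) -
          (1 / (2 * ‖v - cubeCenter v‖)) • (v - cubeCenter v) := by
      rw [cubeProjection, cubeProjection, hc]; abel
    have h2 : u - cubeCenter u - (v - cubeCenter v) = u - v := by rw [hc]; abel
    rw [h1]
    refine (norm_smul_inv_norm_sub_le hu0 hv0).trans ?_
    rw [h2, div_eq_inv_mul]
    gcongr
    calc ‖u - cubeCenter u‖⁻¹ ≤ (η : ℝ)⁻¹ := inv_anti₀ hη' hu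
      _ ≤ (η : ℝ)⁻¹ + 2 := by linarith
  · obtain ⟨i, hi⟩ := Function.ne_iff.1 hc
    have hfl : ⌊u i⌋ ≠ ⌊v i⌋ := fun h => hi (by simp only [cubeCenter, h])
    have h1 := add_half_sub_abs_le_of_floor_ne hfl
    have h2 : |u i - (⌊u i⌋ + 1 / 2)| ≤ ‖u - cubeCenter u‖ := norm_le_pi_norm (u - cubeCenter u) i
    have h3 : |v i - (⌊v i⌋ + 1 / 2)| ≤ ‖v - cubeCenter v‖ := norm_le_pi_norm (v - cubeCenter v) i
    have h4 : |u i - v i| ≤ ‖u - v‖ := norm_le_pi_norm (u - v) i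
    have h5 : cubeProjection u - cubeProjection v =
        (cubeProjection u - u) + (u - v) - (cubeProjection v - v) := by abel
    have h6 : ‖cubeProjection u - cubeProjection v‖ ≤
        ‖cubeProjection u - u‖ + ‖u - v‖ + ‖cubeProjection v - v‖ := by
      rw [h5]
      exact (norm_sub_le _ _).trans (add_le_add_left (norm_add_le _ _) _)
    rw [norm_cubeProjection_sub hu0, norm_cubeProjection_sub hv0] at h6
    have h7 : 0 ≤ (η : ℝ)⁻¹ * ‖u - v‖ := by positivity
    linarith

end Skeleton

/-- The points of `ℝ^n` with a coordinate in a countable set form a null set. -/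
theorem hausdorffMeasure_setOf_exists_coord_mem {n : ℕ} {A : Set ℝ} (hA : A.Countable) :
    μH[n] {p : EuclideanSpace ℝ (Fin n) | ∃ i, p i ∈ A} = 0 := by
  refine Measure.absolutelyContinuous_isAddHaarMeasure _ volume ?_
  have hU : {p : EuclideanSpace ℝ (Fin n) | ∃ i, p i ∈ A} =
      ⋃ i, ⋃ a ∈ A, WithLp.ofLp ⁻¹' {f : Fin n → ℝ | f i = a} := by
    ext p; simp
  rw [hU]
  refine measure_iUnion_null fun i => (measure_biUnion_null_iff hA).2 fun a _ => ?_
  have hm : MeasurableSet {f : Fin n → ℝ | f i = a} :=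
    measurableSet_eq_fun (measurable_pi_apply i) measurable_const
  rw [(PiLp.volume_preserving_ofLp (Fin n)).measure_preimage hm.nullMeasurableSet, volume_pi]
  exact Measure.pi_hyperplane (fun _ : Fin n => (volume : Measure ℝ)) i a

/-- Coordinatewise projection to the unit cube. -/
noncomputable def clampUnit {ι : Type*} (v : ι → ℝ) : ι → ℝ := fun i => max 0 (min 1 (v i))

theorem lipschitzWith_clampUnit {ι : Type*} [Fintype ι] : LipschitzWith 1 (clampUnit (ι := ι)) :=
  LipschitzWith.of_dist_le_mul fun v w => (dist_pi_le_iff (by positivity)).2 fun i =>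
    (((LipschitzWith.id.const_min 1).const_max 0).dist_le_mul (v i) (w i)).trans
      (mul_le_mul_of_nonneg_left (dist_le_pi_dist v w i) (by positivity))

theorem clampUnit_mem_Icc {ι : Type*} (v : ι → ℝ) (i : ι) : clampUnit v i ∈ Icc (0 : ℝ) 1 :=
  ⟨le_max_left _ _, max_le zero_le_one (min_le_left _ _)⟩

theorem clampUnit_eq_self {ι : Type*} {v : ι → ℝ} (h : ∀ i, v i ∈ Icc (0 : ℝ) 1) :
    clampUnit v = v := by
  ext i
  rw [clampUnit, min_eq_right (h i).2, max_eq_right (h i).1]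

theorem clampUnit_int_div {ι : Type*} {v : ι → ℝ} {i : ι} {N : ℝ} {k : ℤ}
    (h : v i = k / N) : clampUnit v i ∈ range (fun k : ℤ => (k : ℝ) / N) ∪ {1} := by
  rw [clampUnit, h]
  rcases max_choice 0 (min 1 ((k : ℝ) / N)) with h | h <;> rw [h]
  · exact Or.inl ⟨0, by simp⟩
  · rcases min_choice 1 ((k : ℝ) / N) with h | h <;> rw [h]
    · exact Or.inr rfl
    · exact Or.inl ⟨k, rfl⟩

/-- The centres of the cubes of side `1 / N` form a countable closed set. -/
theorem countable_isClosed_setOf_cube_centers (n : ℕ) {N : ℝ} (hN : 0 < N) :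
    {c : EuclideanSpace ℝ (Fin n) | ∀ i, N * c i - 1 / 2 ∈ range ((↑) : ℤ → ℝ)}.Countable ∧
    IsClosed {c : EuclideanSpace ℝ (Fin n) | ∀ i, N * c i - 1 / 2 ∈ range ((↑) : ℤ → ℝ)} := by
  constructor
  · refine (countable_range fun k : Fin n → ℤ =>
      (WithLp.toLp 2 fun i => ((k i : ℝ) + 1 / 2) / N : EuclideanSpace ℝ (Fin n))).mono ?_
    intro c hc
    choose k hk using hc
    refine ⟨k, ?_⟩
    ext i
    simp only [hk]
    field_simp
    ring
  · simp only [ofPred_forall]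
    refine isClosed_iInter fun i => ?_
    exact Int.isClosedEmbedding_coe_real.isClosed_range.preimage
      (f := fun c : EuclideanSpace ℝ (Fin n) => N * c i - 1 / 2) (by fun_prop)

theorem exists_lipschitzWith_null_range {X : Type*} [MetricSpace X]
    [MeasurableSpace X] [BorelSpace X] [CompactSpace X] {m : ℕ}
    (hunrect : ∀ E : Set X, IsRectifiableSet (m + 1) E → μH[(m + 1 : ℕ)] E = 0)
    (hfin : μH[(m + 1 : ℕ)] (univ : Set X) ≠ ∞)
    {g : X → EuclideanSpace ℝ (Fin (m + 1))} (hg : Continuous g)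
    (hgc : ∀ x, g x ∈ unitCube (m + 1)) {ε : ℝ} (hε : 0 < ε) :
    ∃ f : X → EuclideanSpace ℝ (Fin (m + 1)), (∃ K : ℝ≥0, LipschitzWith K f) ∧
      (∀ x, f x ∈ unitCube (m + 1)) ∧ μH[(m + 1 : ℕ)] (range f) = 0 ∧
      ∀ x, dist (f x) (g x) < ε := by
  have hL := PiLp.lipschitzWith_toLp 2 (fun _ : Fin (m + 1) => ℝ)
  set L : ℝ≥0 := (Fintype.card (Fin (m + 1)) : ℝ≥0) ^ (1 / (2 : ℝ≥0∞)).toReal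
  obtain ⟨N, hN0, hN⟩ : ∃ N : ℝ≥0, 0 < N ∧ L / N < ε := by
    refine ⟨Real.toNNReal ((L + 1) / ε), by simp; positivity, ?_⟩
    rw [Real.coe_toNNReal _ (by positivity), div_div_eq_mul_div, div_lt_iff₀ (by positivity)]
    nlinarith
  have hN0' : (0 : ℝ) < N := hN0
  obtain ⟨hSc, hS⟩ := countable_isClosed_setOf_cube_centers (m + 1) hN0'
  obtain ⟨f₁, ⟨K, hK⟩, hf₁, δ, hδ, hsep⟩ := exists_lipschitzWith_away_from_countable hunrect hfin hg
    hSc hS (show 0 < (N : ℝ)⁻¹ / 2 by positivity)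
  set u : X → Fin (m + 1) → ℝ := fun x => (N : ℝ) • WithLp.ofLp (f₁ x) with hu
  have huL : LipschitzWith (N * K) u := by
    refine LipschitzWith.of_dist_le_mul fun x y => ?_
    rw [hu, dist_smul₀, Real.norm_of_nonneg N.coe_nonneg, NNReal.coe_mul, mul_assoc]
    gcongr
    simpa using ((PiLp.lipschitzWith_ofLp 2 (fun _ : Fin (m + 1) => ℝ)).comp hK).dist_le_mul x y
  obtain ⟨η, hη, hηu⟩ : ∃ η : ℝ≥0, 0 < η ∧ ∀ x, (η : ℝ) ≤ ‖u x - cubeCenter (u x)‖ := by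
    refine ⟨Real.toNNReal (δ * N / (L + 1)), by simp; positivity, fun x => ?_⟩
    rw [Real.coe_toNNReal _ (by positivity), div_le_iff₀ (by positivity)]
    have h1 := hsep x (WithLp.toLp 2 ((N : ℝ)⁻¹ • cubeCenter (u x))) fun i => by
      refine ⟨⌊u x i⌋, ?_⟩
      simp only [Pi.smul_apply, smul_eq_mul, cubeCenter]
      field_simp
      ring
    have h2 := hL.dist_le_mul (WithLp.ofLp (f₁ x)) ((N : ℝ)⁻¹ • cubeCenter (u x))
    have h3 : WithLp.ofLp (f₁ x) = (N : ℝ)⁻¹ • u x := by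
      rw [hu, inv_smul_smul₀ hN0'.ne']
    rw [WithLp.toLp_ofLp] at h2
    rw [h3, dist_smul₀, Real.norm_of_nonneg (by positivity), dist_eq_norm (u x)] at h2
    have h4 := h1.trans h2
    rw [inv_mul_eq_div, ← mul_div_assoc, le_div_iff₀ hN0'] at h4
    nlinarith [norm_nonneg (u x - cubeCenter (u x))]
  have hpos : ∀ x, 0 < ‖u x - cubeCenter (u x)‖ := fun x =>
    (NNReal.coe_pos.2 hη).trans_le (hηu x)
  have hq : LipschitzWith ((η⁻¹ + 2) * (N * K)) fun x => cubeProjection (u x) := by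
    rw [← lipschitzOnWith_univ]
    exact (lipschitzOnWith_cubeProjection hη).comp huL.lipschitzOnWith fun x _ => hηu x
  refine ⟨fun x => WithLp.toLp 2 (clampUnit ((N : ℝ)⁻¹ • cubeProjection (u x))),
    ⟨_, hL.comp (lipschitzWith_clampUnit.comp ((lipschitzWith_smul (N : ℝ)⁻¹).comp hq))⟩,
    fun x i => clampUnit_mem_Icc _ i, ?_, fun x => ?_⟩
  · refine measure_mono_null ?_ (hausdorffMeasure_setOf_exists_coord_mem
      (A := range (fun k : ℤ => (k : ℝ) / N) ∪ {1})
      ((countable_range _).union (countable_singleton 1)))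
    rintro _ ⟨x, rfl⟩
    obtain ⟨i, k, hk⟩ := exists_cubeProjection_eq_int (hpos x)
    refine ⟨i, clampUnit_int_div (k := k) ?_⟩
    rw [Pi.smul_apply, hk, smul_eq_mul, inv_mul_eq_div]
  · have h1 : dist ((N : ℝ)⁻¹ • cubeProjection (u x)) (WithLp.ofLp (f₁ x)) ≤ (N : ℝ)⁻¹ / 2 := by
      have h3 : WithLp.ofLp (f₁ x) = (N : ℝ)⁻¹ • u x := by
        rw [hu, inv_smul_smul₀ hN0'.ne']
      rw [h3, dist_smul₀, dist_eq_norm, norm_cubeProjection_sub (hpos x),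
        Real.norm_of_nonneg (by positivity)]
      linarith [mul_pos (inv_pos.2 hN0') (hpos x)]
    have h2 : dist (WithLp.ofLp (f₁ x)) (WithLp.ofLp (g x)) ≤ (N : ℝ)⁻¹ / 2 := by
      refine le_trans ?_ (hf₁ x).le
      simpa using (PiLp.lipschitzWith_ofLp 2 (fun _ : Fin (m + 1) => ℝ)).dist_le_mul (f₁ x) (g x)
    have h3 : dist (clampUnit ((N : ℝ)⁻¹ • cubeProjection (u x))) (WithLp.ofLp (g x)) ≤
        (N : ℝ)⁻¹ := by
      have h4 := lipschitzWith_clampUnit.dist_le_mul ((N : ℝ)⁻¹ • cubeProjection (u x))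
        (WithLp.ofLp (g x))
      rw [clampUnit_eq_self (hgc x), NNReal.coe_one, one_mul] at h4
      linarith [dist_triangle ((N : ℝ)⁻¹ • cubeProjection (u x)) (WithLp.ofLp (f₁ x))
        (WithLp.ofLp (g x))]
    calc dist (WithLp.toLp 2 (clampUnit ((N : ℝ)⁻¹ • cubeProjection (u x)))) (g x)
        ≤ L * dist (clampUnit ((N : ℝ)⁻¹ • cubeProjection (u x))) (WithLp.ofLp (g x)) :=
          hL.dist_le_mul _ (WithLp.ofLp (g x))
      _ ≤ L * (N : ℝ)⁻¹ := by gcongr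
      _ < ε := by rwa [← div_eq_mul_inv]

/-- A purely `0`-unrectifiable space is empty. -/
theorem isEmpty_of_forall_isRectifiableSet_zero {X : Type*} [MetricSpace X] [MeasurableSpace X]
    [BorelSpace X] (hunrect : ∀ E : Set X, IsRectifiableSet 0 E → μH[(0 : ℕ)] E = 0) :
    IsEmpty X := by
  refine ⟨fun x => ?_⟩
  have h := hunrect {x} ⟨measurableSet_singleton x, fun _ => univ, fun _ _ => x,
    fun _ => .univ, fun _ => ⟨0, (LipschitzWith.const x).lipschitzOnWith⟩, by simp⟩
  rw [Nat.cast_zero, Measure.hausdorffMeasure_zero_singleton] at h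
  exact one_ne_zero h

/-- If `X` is a compact, purely `n`-unrectifiable metric space with `H^n(X) < ∞` and positive
lower `n`-density `H^n`-a.e., then every continuous `g : X → [0,1]^n` is a uniform limit of
Lipschitz maps `f i : X → [0,1]^n` with `H^n(f i '' X) = 0`. -/
theorem stmt1 {X : Type*} [MetricSpace X] [MeasurableSpace X] [BorelSpace X]
    [CompactSpace X] (n : ℕ)
    (hunrect : ∀ E : Set X, IsRectifiableSet n E → μH[n] E = 0)
    (hfin : μH[n] (univ : Set X) < ∞)
    (hld : ∀ᵐ x ∂(μH[n] : Measure X),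
      0 < liminf (fun r : ℝ => μH[n] (closedBall x r) / ENNReal.ofReal (r ^ n)) (𝓝[>] 0))
    (g : X → EuclideanSpace ℝ (Fin n)) (hg : Continuous g) (hgc : ∀ x, g x ∈ unitCube n) :
    ∃ f : ℕ → X → EuclideanSpace ℝ (Fin n),
      (∀ i, ∃ K : ℝ≥0, LipschitzWith K (f i)) ∧
      (∀ i x, f i x ∈ unitCube n) ∧
      (∀ i, μH[n] (Set.range (f i)) = 0) ∧
      TendstoUniformly f g atTop := by
  rcases n with _ | m
  · have := isEmpty_of_forall_isRectifiableSet_zero hunrect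
    exact ⟨fun _ => g, fun _ => ⟨0, fun x => isEmptyElim x⟩, fun _ => hgc,
      fun _ => by simp [range_eq_empty], fun _ _ => .of_forall fun _ x => isEmptyElim x⟩
  have h := fun i : ℕ => exists_lipschitzWith_null_range hunrect hfin.ne hg hgc
    (show (0 : ℝ) < 1 / (i + 1) by positivity)
  choose f hf hfc hf0 hfg using h
  refine ⟨f, hf, hfc, hf0, Metric.tendstoUniformly_iff.2 fun ε hε => ?_⟩
  obtain ⟨i₀, hi₀⟩ := exists_nat_one_div_lt hε
  filter_upwards [eventually_ge_atTop i₀] with i hi x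
  rw [dist_comm]
  refine (hfg i x).trans_le (le_trans ?_ hi₀.le)
  gcongr
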